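/- If in addition ‖O_j‖ ≤ N_O and ‖Π O_j Π − O_j Π‖ ≤ ε for all j = 1, …, N, then |Q(O_N ⋯ O_1 ρ) − Q((Π O_N Π)(Π O_{N-1} Π) ⋯ (Π O_1 Π) ρ)| ≤ N_Q N_ρ ((N_O + ε)^N − N_O^N). -/

import Mathlib

/-- `seqRangeL O a b` is the composition `O_{b-1} ∘ ⋯ ∘ O_{a+1} ∘ O_a` (the map `O_a` is
applied first); for `b ≤ a` it is the identity. -/
def seqRangeL {E : Type*} [NormedAddCommGroup E] [NormedSpace ℝ E]
    (O : ℕ → E →L[ℝ] E) (a b : ℕ) : E →L[ℝ] E :=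
  (List.range' a (b - a)).foldl (fun acc j => (O j).comp acc) (ContinuousLinearMap.id ℝ E)

theorem seqRangeL_succ {E : Type*} [NormedAddCommGroup E] [NormedSpace ℝ E]
    (O : ℕ → E →L[ℝ] E) (k : ℕ) (x : E) :
    seqRangeL O 0 (k + 1) x = O k (seqRangeL O 0 k x) := by
  simp [seqRangeL, List.range'_concat]

/-- If `‖O_j‖ ≤ N_O` and `‖Π O_j Π − O_j Π‖ ≤ ε` for all `j = 1, …, N` (indexed
`0, …, N-1` here), then
`|Q(O_N ⋯ O_1 ρ) − Q((Π O_N Π) ⋯ (Π O_1 Π) ρ)| ≤ N_Q N_ρ ((N_O + ε)^N − N_O^N)`. -/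
theorem stmt10 {E : Type*} [NormedAddCommGroup E] [NormedSpace ℝ E]
    (ρ : E) (Q : E →L[ℝ] ℝ) (Nρ NQ : ℝ) (hρ : ‖ρ‖ ≤ Nρ) (hQ : ‖Q‖ ≤ NQ)
    (N : ℕ) (O : ℕ → E →L[ℝ] E)
    (Pr : E →L[ℝ] E) (hPr : Pr.comp Pr = Pr) (hPrρ : Pr ρ = ρ)
    (NO ε : ℝ)
    (hO : ∀ j < N, ‖O j‖ ≤ NO)
    (hδ : ∀ j < N, ‖Pr.comp ((O j).comp Pr) - (O j).comp Pr‖ ≤ ε) :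
    |Q (seqRangeL O 0 N ρ)
      - Q (seqRangeL (fun j => Pr.comp ((O j).comp Pr)) 0 N ρ)|
    ≤ NQ * Nρ * ((NO + ε) ^ N - NO ^ N) := by
  have key : ∀ k ≤ N,
      Pr (seqRangeL (fun j => Pr.comp ((O j).comp Pr)) 0 k ρ)
        = seqRangeL (fun j => Pr.comp ((O j).comp Pr)) 0 k ρ ∧
      ‖seqRangeL (fun j => Pr.comp ((O j).comp Pr)) 0 k ρ‖ ≤ Nρ * (NO + ε) ^ k ∧
      ‖seqRangeL O 0 k ρ - seqRangeL (fun j => Pr.comp ((O j).comp Pr)) 0 k ρ‖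
        ≤ Nρ * ((NO + ε) ^ k - NO ^ k) := by
    intro k
    induction k with
    | zero =>
      intro _
      simp [seqRangeL, hPrρ, hρ]
    | succ k ih =>
      intro hk
      obtain ⟨h1, h2, h3⟩ := ih (by omega)
      rw [seqRangeL_succ, seqRangeL_succ]
      generalize seqRangeL (fun j => Pr.comp ((O j).comp Pr)) 0 k ρ = y at *
      generalize seqRangeL O 0 k ρ = x at *
      have hOk := hO k (by omega)
      have hδk := hδ k (by omega)
      have hNO : 0 ≤ NO := (norm_nonneg _).trans hOk
      have hε : 0 ≤ ε := (norm_nonneg _).trans hδk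
      have e1 : ‖Pr (O k y) - O k y‖ ≤ ε * ‖y‖ := by
        have := (Pr.comp ((O k).comp Pr) - (O k).comp Pr).le_of_opNorm_le hδk y
        simpa [h1] using this
      have e2 : ‖O k y‖ ≤ NO * ‖y‖ := (O k).le_of_opNorm_le hOk y
      have e3 : ‖O k (x - y)‖ ≤ NO * ‖x - y‖ := (O k).le_of_opNorm_le hOk _
      simp only [ContinuousLinearMap.comp_apply, h1]
      refine ⟨?_, ?_, ?_⟩
      · exact congrArg (fun f => f (O k y)) hPr
      · calc ‖Pr (O k y)‖ = ‖(Pr (O k y) - O k y) + O k y‖ := by simp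
          _ ≤ ε * ‖y‖ + NO * ‖y‖ := (norm_add_le _ _).trans (add_le_add e1 e2)
          _ = (NO + ε) * ‖y‖ := by ring
          _ ≤ (NO + ε) * (Nρ * (NO + ε) ^ k) := by gcongr
          _ = _ := by ring
      · calc ‖O k x - Pr (O k y)‖ = ‖O k (x - y) - (Pr (O k y) - O k y)‖ := by
              rw [map_sub]; congr 1; abel
          _ ≤ NO * ‖x - y‖ + ε * ‖y‖ := (norm_sub_le _ _).trans (add_le_add e3 e1)
          _ ≤ NO * (Nρ * ((NO + ε) ^ k - NO ^ k)) + ε * (Nρ * (NO + ε) ^ k) := by gcongr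
          _ = _ := by ring
  have h3 := (key N le_rfl).2.2
  rw [← map_sub, ← Real.norm_eq_abs, mul_assoc]
  have hNQ : 0 ≤ NQ := (norm_nonneg _).trans hQ
  exact (Q.le_of_opNorm_le hQ _).trans (mul_le_mul_of_nonneg_left h3 hNQ)
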